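/- Let d, n ≥ 1 and f < n, and let H ⊆ {1,…,n} with |H| = n − f ≥ 1. For each i ∈ H let ℒ_i : ℝ^d → ℝ be differentiable with L_i-Lipschitz gradient, and let ℒ_H = (1/(n−f))·∑_{i∈H} ℒ_i be differentiable with L-Lipschitz gradient (L > 0) and lower bounded, with ℒ_H* = ⨅ ℒ_H > −∞. Set L̃² = (1/(n−f))·∑_{i∈H} L_i², with L̃ > 0. Suppose the heterogeneity bound (1/(n−f))·∑_{i∈H} ‖∇ℒ_i(x) − ∇ℒ_H(x)‖² ≤ G² holds for all x ∈ ℝ^d. Let 𝒞 : ℝ^d → ℝ^d satisfy ‖𝒞(z) − z‖² ≤ (1−α)‖z‖² for all z, with α ∈ (0,1], and let F : (ℝ^d)^n → ℝ^d be an (f,κ)-robust aggregation rule with κ ≥ 0. Let η ∈ (0,1] and γ > 0 with γ ≤ min{ α/(8·L̃·√(3(6κ+1))), η/(2·√(3(6κ·L̃² + L²))) }. Let b_i : ℕ → ℝ^d be arbitrary sequences for i ∉ H (the Byzantine workers' vectors). Define sequences x^t ∈ ℝ^d and, for i ∈ H, v_i^t, g_i^t ∈ ℝ^d by: x^0 ∈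 ℝ^d arbitrary, v_i^0 = g_i^0 = ∇ℒ_i(x^0) for i ∈ H; for all t ≥ 0, x^{t+1} = x^t − γ·F(w_1^t, …, w_n^t) where w_i^t = g_i^t for i ∈ H and w_i^t = b_i(t) for i ∉ H; and for i ∈ H, v_i^{t+1} = (1−η)·v_i^t + η·∇ℒ_i(x^{t+1}) and g_i^{t+1} = g_i^t + 𝒞(v_i^{t+1} − g_i^t). Then for every T ≥ 1, (1/T)·∑_{t=0}^{T−1} ‖∇ℒ_H(x^t)‖² ≤ 2(ℒ_H(x^0) − ℒ_H*)/(γT) + 18κ·G². -/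

import Mathlib

lemma aux_descent {E : Type*} [NormedAddCommGroup E] [InnerProductSpace ℝ E] [CompleteSpace E]
    (φ : E → ℝ) (L : ℝ) (hd : Differentiable ℝ φ)
    (hL : ∀ x y, ‖gradient φ x - gradient φ y‖ ≤ L * ‖x - y‖) (x h : E) :
    φ (x + h) ≤ φ x + inner ℝ (gradient φ x) h + L / 2 * ‖h‖ ^ 2 := by
  have hder : ∀ s : ℝ, HasDerivAt
      (fun s : ℝ => φ (x + s • h) - s * inner ℝ (gradient φ x) h - L / 2 * ‖h‖ ^ 2 * s ^ 2)
      (inner ℝ (gradient φ (x + s • h)) h - inner ℝ (gradient φ x) h - L * ‖h‖ ^ 2 * s) s := by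
    intro s
    have h1 : HasDerivAt (fun s : ℝ => x + s • h) h s := by
      simpa using ((hasDerivAt_id s).smul_const h).const_add x
    have h2 := (hd (x + s • h)).hasGradientAt.hasFDerivAt.comp_hasDerivAt s h1
    have h3 : HasDerivAt (fun s : ℝ => s * inner ℝ (gradient φ x) h)
        (inner ℝ (gradient φ x) h) s := by
      simpa using (hasDerivAt_id s).mul_const (inner ℝ (gradient φ x) h)
    have h4 : HasDerivAt (fun s : ℝ => L / 2 * ‖h‖ ^ 2 * s ^ 2)
        (L * ‖h‖ ^ 2 * s) s := by
      have := (hasDerivAt_pow 2 s).const_mul (L / 2 * ‖h‖ ^ 2)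
      refine this.congr_deriv ?_
      norm_num
      ring
    have h5 := (h2.sub h3).sub h4
    rw [InnerProductSpace.toDual_apply_apply] at h5
    exact h5
  have hanti : AntitoneOn
      (fun s : ℝ => φ (x + s • h) - s * inner ℝ (gradient φ x) h - L / 2 * ‖h‖ ^ 2 * s ^ 2)
      (Set.Ici (0 : ℝ)) := by
    apply antitoneOn_of_deriv_nonpos (convex_Ici 0)
    · exact fun s _ => (hder s).continuousAt.continuousWithinAt
    · exact fun s _ => (hder s).differentiableAt.differentiableWithinAt
    · intro s hs
      rw [interior_Ici] at hs
      have hs : 0 < s := hs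
      rw [(hder s).deriv, ← inner_sub_left]
      have h1 := real_inner_le_norm (gradient φ (x + s • h) - gradient φ x) h
      have h2 := hL (x + s • h) x
      rw [add_sub_cancel_left, norm_smul, Real.norm_eq_abs, abs_of_pos hs] at h2
      have h3 := mul_le_mul_of_nonneg_right h2 (norm_nonneg h)
      nlinarith
  have := hanti (Set.mem_Ici.2 le_rfl) (Set.mem_Ici.2 zero_le_one) zero_le_one
  simp only [one_smul, zero_smul, add_zero] at this
  linarith

lemma aux_B {E : Type*} [NormedAddCommGroup E] [InnerProductSpace ℝ E] (a b : E) (η : ℝ)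
    (h0 : 0 < η) (h1 : η ≤ 1) :
    ‖(1 - η) • (a + b)‖ ^ 2 ≤ (1 - η) * ‖a‖ ^ 2 + ‖b‖ ^ 2 / η := by
  rw [norm_smul, Real.norm_eq_abs, abs_of_nonneg (by linarith), mul_pow]
  have hab : ‖a + b‖ ^ 2 ≤ (‖a‖ + ‖b‖) ^ 2 :=
    pow_le_pow_left₀ (norm_nonneg _) (norm_add_le a b) 2
  refine (mul_le_mul_of_nonneg_left hab (sq_nonneg _)).trans ?_
  generalize ‖a‖ = p
  generalize ‖b‖ = q
  have h2 : 0 ≤ (1 - η) * (η * p - (1 - η) * q) ^ 2 + q ^ 2 * (η * (2 - η)) := by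
    have := mul_nonneg (by linarith : 0 ≤ 1 - η) (sq_nonneg (η * p - (1 - η) * q))
    have := mul_nonneg (sq_nonneg q) (mul_nonneg h0.le (by linarith : 0 ≤ 2 - η))
    linarith
  have h3 : (1 - η) * p ^ 2 + q ^ 2 / η - (1 - η) ^ 2 * (p + q) ^ 2
      = ((1 - η) * (η * p - (1 - η) * q) ^ 2 + q ^ 2 * (η * (2 - η))) / η := by
    field_simp
    ring
  have := div_nonneg h2 h0.le
  linarith

lemma aux_A {E : Type*} [NormedAddCommGroup E] [InnerProductSpace ℝ E] (a b : E) (α : ℝ)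
    (h0 : 0 < α) (h1 : α ≤ 1) :
    (1 - α) * ‖a + b‖ ^ 2 ≤ (1 - α / 2) * ‖a‖ ^ 2 + 2 / α * ‖b‖ ^ 2 := by
  have hab : ‖a + b‖ ^ 2 ≤ (‖a‖ + ‖b‖) ^ 2 :=
    pow_le_pow_left₀ (norm_nonneg _) (norm_add_le a b) 2
  refine (mul_le_mul_of_nonneg_left hab (by linarith)).trans ?_
  generalize ‖a‖ = p
  generalize ‖b‖ = q
  have h2 : 0 ≤ (α * p - 2 * (1 - α) * q) ^ 2 / 2 + q ^ 2 * (α * (3 - α)) := by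
    have := sq_nonneg (α * p - 2 * (1 - α) * q)
    have := mul_nonneg (sq_nonneg q) (mul_nonneg h0.le (by linarith : 0 ≤ 3 - α))
    linarith
  have h3 : (1 - α / 2) * p ^ 2 + 2 / α * q ^ 2 - (1 - α) * (p + q) ^ 2
      = ((α * p - 2 * (1 - α) * q) ^ 2 / 2 + q ^ 2 * (α * (3 - α))) / α := by
    field_simp
    ring
  have := div_nonneg h2 h0.le
  linarith

lemma aux_sq2 {E : Type*} [NormedAddCommGroup E] (a b : E) :
    ‖a + b‖ ^ 2 ≤ 2 * ‖a‖ ^ 2 + 2 * ‖b‖ ^ 2 := by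
  have hab : ‖a + b‖ ^ 2 ≤ (‖a‖ + ‖b‖) ^ 2 :=
    pow_le_pow_left₀ (norm_nonneg _) (norm_add_le a b) 2
  nlinarith [sq_nonneg (‖a‖ - ‖b‖)]

lemma aux_sq3 {E : Type*} [NormedAddCommGroup E] (a b c : E) :
    ‖a + b + c‖ ^ 2 ≤ 3 * ‖a‖ ^ 2 + 3 * ‖b‖ ^ 2 + 3 * ‖c‖ ^ 2 := by
  have hab : ‖a + b + c‖ ^ 2 ≤ (‖a‖ + ‖b‖ + ‖c‖) ^ 2 :=
    pow_le_pow_left₀ (norm_nonneg _) (norm_add₃_le) 2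
  nlinarith [sq_nonneg (‖a‖ - ‖b‖), sq_nonneg (‖b‖ - ‖c‖), sq_nonneg (‖a‖ - ‖c‖)]

lemma aux_sum (a r : ℕ → ℝ) (c : ℝ) (h0 : a 0 = 0) (ha : ∀ t, 0 ≤ a t)
    (h : ∀ t, a (t + 1) ≤ (1 - c) * a t + r t) (T : ℕ) :
    c * ∑ t ∈ Finset.range T, a t ≤ ∑ t ∈ Finset.range T, r t := by
  have : ∀ T : ℕ, a T + c * ∑ t ∈ Finset.range T, a t ≤ ∑ t ∈ Finset.range T, r t := by
    intro T
    induction T with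
    | zero => simp [h0]
    | succ k ih =>
      rw [Finset.sum_range_succ, Finset.sum_range_succ]
      have := h k
      linarith
  have h1 := this T
  have h2 := ha T
  linarith

/-- Averages: variance is at most the second moment around any point, and Jensen. -/
lemma aux_var {E ι : Type*} [NormedAddCommGroup E] [InnerProductSpace ℝ E] (H : Finset ι)
    (m : ℝ) (hm : 0 < m) (hc : (H.card : ℝ) = m) (u : ι → E) (c : E) :
    m⁻¹ * ∑ i ∈ H, ‖u i - m⁻¹ • ∑ j ∈ H, u j‖ ^ 2 + ‖m⁻¹ • ∑ j ∈ H, u j - c‖ ^ 2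
      = m⁻¹ * ∑ i ∈ H, ‖u i - c‖ ^ 2 := by
  set ub := m⁻¹ • ∑ j ∈ H, u j with hub
  have hsum : ∑ i ∈ H, (u i - ub) = 0 := by
    rw [Finset.sum_sub_distrib, Finset.sum_const, ← Nat.cast_smul_eq_nsmul ℝ, hc, hub, smul_smul,
      mul_inv_cancel₀ hm.ne', one_smul, sub_self]
  have h1 : ∀ i ∈ H, ‖u i - c‖ ^ 2
      = ‖u i - ub‖ ^ 2 + 2 * inner ℝ (u i - ub) (ub - c) + ‖ub - c‖ ^ 2 := by
    intro i _
    rw [← norm_add_sq_real, sub_add_sub_cancel]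
  rw [Finset.sum_congr rfl h1, Finset.sum_add_distrib, Finset.sum_add_distrib, ← Finset.mul_sum,
    ← sum_inner, hsum, inner_zero_left, Finset.sum_const, nsmul_eq_mul, hc]
  field_simp
  ring

lemma aux_final (A B P R D N : ℕ → ℝ) (Ds L Lt κ G α η γ : ℝ) (hL : 0 < L) (hLt : 0 < Lt)
    (hα : 0 < α) (hκ : 0 ≤ κ) (hη : 0 < η) (hη1 : η ≤ 1) (hγ : 0 < γ)
    (hγle : γ ≤ min (α / (8 * Lt * Real.sqrt (3 * (6 * κ + 1))))
      (η / (2 * Real.sqrt (3 * (6 * κ * Lt ^ 2 + L ^ 2)))))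
    (hA : ∀ t, 0 ≤ A t) (hB : ∀ t, 0 ≤ B t) (hP : ∀ t, 0 ≤ P t) (hR : ∀ t, 0 ≤ R t)
    (hA0 : A 0 = 0) (hB0 : B 0 = 0) (hP0 : P 0 = 0)
    (hAs : ∀ t, A (t + 1) ≤ (1 - α / 2) * A t + 4 * η ^ 2 / α * (Lt ^ 2 * R t + B t))
    (hBs : ∀ t, B (t + 1) ≤ (1 - η) * B t + Lt ^ 2 * R t / η)
    (hPs : ∀ t, P (t + 1) ≤ (1 - η) * P t + L ^ 2 * R t / η)
    (hD : ∀ t, D (t + 1) ≤ D t - γ / 2 * N t - (1 / (2 * γ) - L / 2) * R t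
      + γ / 2 * (3 * (6 * κ + 1) * A t + 18 * κ * B t + 3 * P t + 18 * κ * G ^ 2))
    (hDs : ∀ t, Ds ≤ D t) (T : ℕ) (hT : 1 ≤ T) :
    (1 / (T : ℝ)) * ∑ t ∈ Finset.range T, N t ≤
      2 * (D 0 - Ds) / (γ * T) + 18 * κ * G ^ 2 := by
  have hTp : (0 : ℝ) < T := by exact_mod_cast hT
  set SA := ∑ t ∈ Finset.range T, A t with hSA
  set SB := ∑ t ∈ Finset.range T, B t with hSB
  set SP := ∑ t ∈ Finset.range T, P t with hSP
  set SR := ∑ t ∈ Finset.range T, R t with hSR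
  set SN := ∑ t ∈ Finset.range T, N t with hSN
  have hSR0 : 0 ≤ SR := Finset.sum_nonneg fun t _ => hR t
  have h1 : α / 2 * SA ≤ 4 * η ^ 2 / α * (Lt ^ 2 * SR + SB) := by
    have := aux_sum A _ (α / 2) hA0 hA hAs T
    rwa [← Finset.mul_sum, Finset.sum_add_distrib, ← Finset.mul_sum] at this
  have h2 : η * SB ≤ Lt ^ 2 * SR / η := by
    have := aux_sum B _ η hB0 hB hBs T
    rwa [← Finset.sum_div, ← Finset.mul_sum] at this
  have h3 : η * SP ≤ L ^ 2 * SR / η := by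
    have := aux_sum P _ η hP0 hP hPs T
    rwa [← Finset.sum_div, ← Finset.mul_sum] at this
  have h4 : ∀ k : ℕ, D k ≤ D 0 - γ / 2 * ∑ t ∈ Finset.range k, N t
      - (1 / (2 * γ) - L / 2) * ∑ t ∈ Finset.range k, R t
      + γ / 2 * (3 * (6 * κ + 1) * ∑ t ∈ Finset.range k, A t
        + 18 * κ * ∑ t ∈ Finset.range k, B t
        + 3 * ∑ t ∈ Finset.range k, P t + 18 * κ * G ^ 2 * k) := by
    intro k
    induction k with
    | zero => simp
    | succ k ih =>
      simp only [Finset.sum_range_succ]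
      push_cast
      linarith [hD k]
  have h5 := h4 T
  rw [← hSA, ← hSB, ← hSP, ← hSR, ← hSN] at h5
  have h2' : η ^ 2 * SB ≤ Lt ^ 2 * SR := by
    rw [le_div_iff₀ hη] at h2
    linarith
  have h3' : η ^ 2 * SP ≤ L ^ 2 * SR := by
    rw [le_div_iff₀ hη] at h3
    linarith
  have h1' : α ^ 2 * SA ≤ 16 * (Lt ^ 2 * SR) := by
    have e : 4 * η ^ 2 / α * (Lt ^ 2 * SR + SB) = (4 * η ^ 2 * (Lt ^ 2 * SR + SB)) / α := by ring
    rw [e, le_div_iff₀ hα] at h1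
    have : η ^ 2 * (Lt ^ 2 * SR) ≤ 1 * (Lt ^ 2 * SR) :=
      mul_le_mul_of_nonneg_right (by nlinarith) (by positivity)
    have h2'' := h2'
    linarith
  obtain ⟨hg1, hg2⟩ := le_min_iff.1 hγle
  have q1 : 192 * γ ^ 2 * (6 * κ + 1) * Lt ^ 2 ≤ α ^ 2 := by
    rw [le_div_iff₀ (by positivity)] at hg1
    have := pow_le_pow_left₀ (by positivity) hg1 2
    rw [mul_pow, mul_pow, Real.sq_sqrt (by positivity)] at this
    linarith
  have q2 : 12 * γ ^ 2 * (6 * κ * Lt ^ 2 + L ^ 2) ≤ η ^ 2 := by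
    rw [le_div_iff₀ (by positivity)] at hg2
    have := pow_le_pow_left₀ (by positivity) hg2 2
    rw [mul_pow, mul_pow, Real.sq_sqrt (by positivity)] at this
    linarith
  have q3 : γ * L ≤ 1 / 2 := by
    have : 0 ≤ γ ^ 2 * (6 * κ * Lt ^ 2) := by positivity
    have : (γ * L) ^ 2 ≤ (1 / 2) ^ 2 := by nlinarith
    exact le_of_sq_le_sq this (by norm_num)
  -- weighted bounds
  have r1 : γ ^ 2 * (3 * (6 * κ + 1) * SA) ≤ SR / 4 := by
    have a1 : α ^ 2 * (γ ^ 2 * (3 * (6 * κ + 1) * SA)) ≤ α ^ 2 * (SR / 4) := by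
      have := mul_le_mul_of_nonneg_left h1' (by positivity : 0 ≤ γ ^ 2 * (3 * (6 * κ + 1)))
      have := mul_le_mul_of_nonneg_right q1 hSR0
      linarith
    exact le_of_mul_le_mul_left a1 (by positivity)
  have r2 : γ ^ 2 * (18 * κ * SB + 3 * SP) ≤ SR / 4 := by
    have a1 : η ^ 2 * (γ ^ 2 * (18 * κ * SB + 3 * SP)) ≤ η ^ 2 * (SR / 4) := by
      have := mul_le_mul_of_nonneg_left h2' (by positivity : 0 ≤ γ ^ 2 * (18 * κ))
      have := mul_le_mul_of_nonneg_left h3' (by positivity : 0 ≤ γ ^ 2 * 3)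
      have := mul_le_mul_of_nonneg_right q2 hSR0
      linarith
    exact le_of_mul_le_mul_left a1 (by positivity)
  have r3 : γ * L * SR ≤ SR / 2 := by
    have := mul_le_mul_of_nonneg_right q3 hSR0
    linarith
  have key : γ / 2 * (3 * (6 * κ + 1) * SA + 18 * κ * SB + 3 * SP)
      ≤ (1 / (2 * γ) - L / 2) * SR := by
    have e : (1 / (2 * γ) - L / 2) * SR = (SR - γ * L * SR) / (2 * γ) := by
      field_simp
    rw [e, le_div_iff₀ (by positivity)]
    linarith
  have h6 := hDs T
  have h7 : γ * SN ≤ 2 * (D 0 - Ds) + γ * T * (18 * κ * G ^ 2) := by linarith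
  have e : 2 * (D 0 - Ds) / (γ * T) + 18 * κ * G ^ 2
      = (2 * (D 0 - Ds) + γ * T * (18 * κ * G ^ 2)) / (γ * T) := by
    field_simp
  rw [e, le_div_iff₀ (by positivity)]
  have : 1 / (T : ℝ) * SN * (γ * T) = γ * SN := by field_simp
  linarith


/-- Theorem 1 of the paper (Byz-EF21-SGDM) in the full-gradient case `σ = 0`
with a deterministic contractive compressor. -/
theorem stmt_14 (d n f : ℕ) (hd : 1 ≤ d) (hn : 1 ≤ n) (hfn : f < n)
    (H : Finset (Fin n)) (hHcard : H.card = n - f)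
    (ℒ : Fin n → EuclideanSpace ℝ (Fin d) → ℝ) (Li : Fin n → ℝ)
    (hdiff : ∀ i ∈ H, Differentiable ℝ (ℒ i))
    (hLip : ∀ i ∈ H, ∀ x y, ‖gradient (ℒ i) x - gradient (ℒ i) y‖ ≤ Li i * ‖x - y‖)
    (LH : EuclideanSpace ℝ (Fin d) → ℝ)
    (hLHdef : ∀ x, LH x = ((n : ℝ) - f)⁻¹ * ∑ i ∈ H, ℒ i x)
    (L : ℝ) (hL : 0 < L)
    (hLHdiff : Differentiable ℝ LH)
    (hLHLip : ∀ x y, ‖gradient LH x - gradient LH y‖ ≤ L * ‖x - y‖)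
    (hbdd : BddBelow (Set.range LH))
    (Ltil : ℝ) (hLtil : 0 < Ltil)
    (hLtilsq : Ltil ^ 2 = ((n : ℝ) - f)⁻¹ * ∑ i ∈ H, Li i ^ 2)
    (G : ℝ)
    (hhet : ∀ x, ((n : ℝ) - f)⁻¹ *
      ∑ i ∈ H, ‖gradient (ℒ i) x - gradient LH x‖ ^ 2 ≤ G ^ 2)
    (C : EuclideanSpace ℝ (Fin d) → EuclideanSpace ℝ (Fin d)) (α : ℝ)
    (hα : α ∈ Set.Ioc (0 : ℝ) 1)
    (hC : ∀ z, ‖C z - z‖ ^ 2 ≤ (1 - α) * ‖z‖ ^ 2)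
    (F : (Fin n → EuclideanSpace ℝ (Fin d)) → EuclideanSpace ℝ (Fin d))
    (κ : ℝ) (hκ : 0 ≤ κ)
    (hF : ∀ (u : Fin n → EuclideanSpace ℝ (Fin d)) (S : Finset (Fin n)),
      S.card = n - f →
      ‖F u - ((n : ℝ) - f)⁻¹ • ∑ i ∈ S, u i‖ ^ 2 ≤
        (κ / ((n : ℝ) - f)) * ∑ i ∈ S, ‖u i - ((n : ℝ) - f)⁻¹ • ∑ j ∈ S, u j‖ ^ 2)
    (η γ : ℝ) (hη : η ∈ Set.Ioc (0 : ℝ) 1) (hγpos : 0 < γ)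
    (hγle : γ ≤ min (α / (8 * Ltil * Real.sqrt (3 * (6 * κ + 1))))
      (η / (2 * Real.sqrt (3 * (6 * κ * Ltil ^ 2 + L ^ 2)))))
    (b : Fin n → ℕ → EuclideanSpace ℝ (Fin d))
    (x : ℕ → EuclideanSpace ℝ (Fin d))
    (v g : Fin n → ℕ → EuclideanSpace ℝ (Fin d))
    (hv0 : ∀ i ∈ H, v i 0 = gradient (ℒ i) (x 0))
    (hg0 : ∀ i ∈ H, g i 0 = gradient (ℒ i) (x 0))
    (hx : ∀ t, x (t + 1) = x t - γ • F (fun i => if i ∈ H then g i t else b i t))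
    (hv : ∀ i ∈ H, ∀ t, v i (t + 1) = (1 - η) • v i t + η • gradient (ℒ i) (x (t + 1)))
    (hg : ∀ i ∈ H, ∀ t, g i (t + 1) = g i t + C (v i (t + 1) - g i t))
    (T : ℕ) (hT : 1 ≤ T) :
    (1 / (T : ℝ)) * ∑ t ∈ Finset.range T, ‖gradient LH (x t)‖ ^ 2 ≤
      2 * (LH (x 0) - ⨅ y, LH y) / (γ * T) + 18 * κ * G ^ 2 := by
  obtain ⟨hα0, hα1⟩ := hα
  obtain ⟨hη0, hη1⟩ := hη
  obtain ⟨m, hmdef⟩ : ∃ m : ℝ, (n : ℝ) - f = m := ⟨_, rfl⟩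
  have hc : (H.card : ℝ) = m := by rw [hHcard, Nat.cast_sub hfn.le, hmdef]
  have hm : 0 < m := by
    rw [← hmdef]
    have : (f : ℝ) < n := by exact_mod_cast hfn
    linarith
  rw [hmdef] at hLtilsq
  have hmi : 0 < m⁻¹ := inv_pos.2 hm
  -- gradient of the average
  have hgrad : ∀ y, gradient LH y = m⁻¹ • ∑ i ∈ H, gradient (ℒ i) y := by
    intro y
    have e : LH = fun y => m⁻¹ * ∑ i ∈ H, ℒ i y := by
      funext z
      rw [hLHdef z, hmdef]
    have h1 : HasFDerivAt (fun y => m⁻¹ * ∑ i ∈ H, ℒ i y)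
        (m⁻¹ • ∑ i ∈ H, fderiv ℝ (ℒ i) y) y :=
      (HasFDerivAt.fun_sum fun i hi => (hdiff i hi y).hasFDerivAt).const_mul m⁻¹
    rw [← e] at h1
    unfold gradient
    rw [h1.fderiv]
    simp
  have hLi2 : ∀ i ∈ H, ∀ y z, ‖gradient (ℒ i) y - gradient (ℒ i) z‖ ^ 2
      ≤ Li i ^ 2 * ‖y - z‖ ^ 2 := by
    intro i hi y z
    rw [← mul_pow]
    exact pow_le_pow_left₀ (norm_nonneg _) (hLip i hi y z) 2
  have hLavg : ∀ y z, m⁻¹ * ∑ i ∈ H, ‖gradient (ℒ i) y - gradient (ℒ i) z‖ ^ 2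
      ≤ Ltil ^ 2 * ‖y - z‖ ^ 2 := by
    intro y z
    rw [hLtilsq, mul_assoc, Finset.sum_mul]
    exact mul_le_mul_of_nonneg_left (Finset.sum_le_sum fun i hi => hLi2 i hi y z) hmi.le
  have avg_nonneg : ∀ u : Fin n → ℝ, (∀ i ∈ H, 0 ≤ u i) → 0 ≤ m⁻¹ * ∑ i ∈ H, u i :=
    fun u hu => mul_nonneg hmi.le (Finset.sum_nonneg hu)
  have avg_mono : ∀ u w : Fin n → ℝ, (∀ i ∈ H, u i ≤ w i) →
      m⁻¹ * ∑ i ∈ H, u i ≤ m⁻¹ * ∑ i ∈ H, w i :=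
    fun u w h => mul_le_mul_of_nonneg_left (Finset.sum_le_sum h) hmi.le
  refine aux_final
    (fun t => m⁻¹ * ∑ i ∈ H, ‖g i t - v i t‖ ^ 2)
    (fun t => m⁻¹ * ∑ i ∈ H, ‖v i t - gradient (ℒ i) (x t)‖ ^ 2)
    (fun t => ‖m⁻¹ • ∑ i ∈ H, v i t - gradient LH (x t)‖ ^ 2)
    (fun t => ‖x (t + 1) - x t‖ ^ 2) (fun t => LH (x t))
    (fun t => ‖gradient LH (x t)‖ ^ 2) (⨅ y, LH y) L Ltil κ G α η γ hL hLtil hα0 hκ hη0 hη1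
    hγpos hγle ?_ ?_ ?_ ?_ ?_ ?_ ?_ ?_ ?_ ?_ ?_ ?_ T hT
  · exact fun t => avg_nonneg _ fun i _ => sq_nonneg _
  · exact fun t => avg_nonneg _ fun i _ => sq_nonneg _
  · exact fun t => sq_nonneg _
  · exact fun t => sq_nonneg _
  · show m⁻¹ * ∑ i ∈ H, ‖g i 0 - v i 0‖ ^ 2 = 0
    rw [Finset.sum_eq_zero, mul_zero]
    intro i hi
    simp [hg0 i hi, hv0 i hi]
  · show m⁻¹ * ∑ i ∈ H, ‖v i 0 - gradient (ℒ i) (x 0)‖ ^ 2 = 0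
    rw [Finset.sum_eq_zero, mul_zero]
    intro i hi
    simp [hv0 i hi]
  · show ‖m⁻¹ • ∑ i ∈ H, v i 0 - gradient LH (x 0)‖ ^ 2 = 0
    rw [hgrad, Finset.sum_congr rfl hv0]
    simp
  · intro t
    have key : ∀ i ∈ H, ‖g i (t + 1) - v i (t + 1)‖ ^ 2 ≤ (1 - α / 2) * ‖g i t - v i t‖ ^ 2
        + 4 * η ^ 2 / α * (‖gradient (ℒ i) (x (t + 1)) - gradient (ℒ i) (x t)‖ ^ 2
          + ‖v i t - gradient (ℒ i) (x t)‖ ^ 2) := by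
      intro i hi
      have e1 : g i (t + 1) - v i (t + 1)
          = C (v i (t + 1) - g i t) - (v i (t + 1) - g i t) := by
        rw [hg i hi t]
        abel
      have e2 : v i (t + 1) - g i t = (v i t - g i t)
          + η • ((gradient (ℒ i) (x (t + 1)) - gradient (ℒ i) (x t))
            + (gradient (ℒ i) (x t) - v i t)) := by
        rw [hv i hi t]
        module
      have h1 := hC (v i (t + 1) - g i t)
      rw [← e1, e2] at h1
      have h2 := aux_A (v i t - g i t) (η • ((gradient (ℒ i) (x (t + 1)) - gradient (ℒ i) (x t))
            + (gradient (ℒ i) (x t) - v i t))) α hα0 hα1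
      have h3 := aux_sq2 (gradient (ℒ i) (x (t + 1)) - gradient (ℒ i) (x t))
        (gradient (ℒ i) (x t) - v i t)
      rw [norm_smul, mul_pow, Real.norm_eq_abs, sq_abs, norm_sub_rev (v i t) (g i t)] at h2
      rw [norm_sub_rev _ (v i t)] at h3
      have h4 := mul_le_mul_of_nonneg_left h3 (by positivity : 0 ≤ 2 / α * η ^ 2)
      have e3 : 4 * η ^ 2 / α = 2 * (2 / α * η ^ 2) := by ring
      rw [e3]
      linarith
    have h1 := avg_mono _ _ key
    have h2 := mul_le_mul_of_nonneg_left (hLavg (x (t + 1)) (x t))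
      (by positivity : 0 ≤ 4 * η ^ 2 / α)
    rw [Finset.sum_add_distrib, ← Finset.mul_sum, ← Finset.mul_sum, Finset.sum_add_distrib] at h1
    show m⁻¹ * ∑ i ∈ H, ‖g i (t + 1) - v i (t + 1)‖ ^ 2 ≤ (1 - α / 2) *
      (m⁻¹ * ∑ i ∈ H, ‖g i t - v i t‖ ^ 2) + 4 * η ^ 2 / α * (Ltil ^ 2 * ‖x (t + 1) - x t‖ ^ 2
        + m⁻¹ * ∑ i ∈ H, ‖v i t - gradient (ℒ i) (x t)‖ ^ 2)
    linarith
  · intro t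
    have key : ∀ i ∈ H, ‖v i (t + 1) - gradient (ℒ i) (x (t + 1))‖ ^ 2
        ≤ (1 - η) * ‖v i t - gradient (ℒ i) (x t)‖ ^ 2
        + η⁻¹ * ‖gradient (ℒ i) (x (t + 1)) - gradient (ℒ i) (x t)‖ ^ 2 := by
      intro i hi
      have e1 : v i (t + 1) - gradient (ℒ i) (x (t + 1)) = (1 - η) •
          ((v i t - gradient (ℒ i) (x t))
            + (gradient (ℒ i) (x t) - gradient (ℒ i) (x (t + 1)))) := by
        rw [hv i hi t]
        module
      have h1 := aux_B (v i t - gradient (ℒ i) (x t))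
        (gradient (ℒ i) (x t) - gradient (ℒ i) (x (t + 1))) η hη0 hη1
      rw [← e1, norm_sub_rev (gradient (ℒ i) (x t)), div_eq_inv_mul] at h1
      exact h1
    have h1 := avg_mono _ _ key
    have h2 := mul_le_mul_of_nonneg_left (hLavg (x (t + 1)) (x t)) (inv_pos.2 hη0).le
    rw [Finset.sum_add_distrib, ← Finset.mul_sum, ← Finset.mul_sum] at h1
    show m⁻¹ * ∑ i ∈ H, ‖v i (t + 1) - gradient (ℒ i) (x (t + 1))‖ ^ 2 ≤ (1 - η) *
      (m⁻¹ * ∑ i ∈ H, ‖v i t - gradient (ℒ i) (x t)‖ ^ 2)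
        + Ltil ^ 2 * ‖x (t + 1) - x t‖ ^ 2 / η
    rw [div_eq_inv_mul]
    linarith
  · intro t
    show ‖m⁻¹ • ∑ i ∈ H, v i (t + 1) - gradient LH (x (t + 1))‖ ^ 2 ≤
      (1 - η) * ‖m⁻¹ • ∑ i ∈ H, v i t - gradient LH (x t)‖ ^ 2
        + L ^ 2 * ‖x (t + 1) - x t‖ ^ 2 / η
    have e0 : m⁻¹ • ∑ i ∈ H, v i (t + 1)
        = (1 - η) • (m⁻¹ • ∑ i ∈ H, v i t) + η • gradient LH (x (t + 1)) := by
      rw [Finset.sum_congr rfl fun i hi => hv i hi t, Finset.sum_add_distrib, ← Finset.smul_sum,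
        ← Finset.smul_sum, hgrad]
      module
    have e1 : m⁻¹ • ∑ i ∈ H, v i (t + 1) - gradient LH (x (t + 1)) = (1 - η) •
        ((m⁻¹ • ∑ i ∈ H, v i t - gradient LH (x t))
          + (gradient LH (x t) - gradient LH (x (t + 1)))) := by
      rw [e0]
      module
    have h1 := aux_B (m⁻¹ • ∑ i ∈ H, v i t - gradient LH (x t))
      (gradient LH (x t) - gradient LH (x (t + 1))) η hη0 hη1
    rw [← e1, norm_sub_rev (gradient LH (x t))] at h1
    have h2 := pow_le_pow_left₀ (norm_nonneg _) (hLHLip (x (t + 1)) (x t)) 2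
    rw [mul_pow] at h2
    have h3 := div_le_div_of_nonneg_right h2 hη0.le
    linarith
  · intro t
    set w : Fin n → EuclideanSpace ℝ (Fin d) := fun i => if i ∈ H then g i t else b i t with hw
    have hwg : ∀ i ∈ H, w i = g i t := fun i hi => by simp [hw, hi]
    set gb := m⁻¹ • ∑ i ∈ H, g i t with hgb
    set vb := m⁻¹ • ∑ i ∈ H, v i t with hvb
    have hsw : m⁻¹ • ∑ i ∈ H, w i = gb := by rw [Finset.sum_congr rfl hwg]
    have hF1 : ‖F w - gb‖ ^ 2 ≤ κ * (m⁻¹ * ∑ i ∈ H, ‖g i t - gb‖ ^ 2) := by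
      have := hF w H hHcard
      rw [hmdef, hsw, Finset.sum_congr rfl fun i hi => by rw [hwg i hi]] at this
      calc _ ≤ _ := this
        _ = _ := by ring
    have hvar := aux_var H m hm hc (fun i => g i t) (gradient LH (x t))
    have hjen := aux_var H m hm hc (fun i => g i t - v i t) 0
    have h3 := avg_mono _ _ fun i (_ : i ∈ H) => aux_sq3 (g i t - v i t)
      (v i t - gradient (ℒ i) (x t)) (gradient (ℒ i) (x t) - gradient LH (x t))
    simp only [sub_add_sub_cancel, Finset.sum_add_distrib, ← Finset.mul_sum] at h3
    have hh := hhet (x t)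
    rw [hmdef] at hh
    have hn1 : 0 ≤ m⁻¹ * ∑ i ∈ H, ‖(g i t - v i t)
      - m⁻¹ • ∑ j ∈ H, (g j t - v j t)‖ ^ 2 := avg_nonneg _ fun i _ => sq_nonneg _
    simp only [sub_zero] at hjen
    rw [Finset.sum_sub_distrib, smul_sub, ← hgb, ← hvb] at hjen hn1
    simp only [← hgb] at hvar
    have h4 := aux_sq3 (F w - gb) (gb - vb) (vb - gradient LH (x t))
    rw [sub_add_sub_cancel, sub_add_sub_cancel] at h4
    have hA0 : 0 ≤ m⁻¹ * ∑ i ∈ H, ‖g i t - v i t‖ ^ 2 := avg_nonneg _ fun i _ => sq_nonneg _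
    have hB0 : 0 ≤ m⁻¹ * ∑ i ∈ H, ‖v i t - gradient (ℒ i) (x t)‖ ^ 2 :=
      avg_nonneg _ fun i _ => sq_nonneg _
    show LH (x (t + 1)) ≤ LH (x t) - γ / 2 * ‖gradient LH (x t)‖ ^ 2
      - (1 / (2 * γ) - L / 2) * ‖x (t + 1) - x t‖ ^ 2
      + γ / 2 * (3 * (6 * κ + 1) * (m⁻¹ * ∑ i ∈ H, ‖g i t - v i t‖ ^ 2)
        + 18 * κ * (m⁻¹ * ∑ i ∈ H, ‖v i t - gradient (ℒ i) (x t)‖ ^ 2)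
        + 3 * ‖vb - gradient LH (x t)‖ ^ 2 + 18 * κ * G ^ 2)
    have hvar2 : m⁻¹ * ∑ i ∈ H, ‖g i t - gb‖ ^ 2 ≤
        3 * (m⁻¹ * ∑ i ∈ H, ‖g i t - v i t‖ ^ 2)
        + 3 * (m⁻¹ * ∑ i ∈ H, ‖v i t - gradient (ℒ i) (x t)‖ ^ 2) + 3 * G ^ 2 := by
      have := sq_nonneg ‖gb - gradient LH (x t)‖
      linarith
    have hvar3 := mul_le_mul_of_nonneg_left hvar2 hκ
    have herr : ‖F w - gradient LH (x t)‖ ^ 2 ≤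
        3 * (6 * κ + 1) * (m⁻¹ * ∑ i ∈ H, ‖g i t - v i t‖ ^ 2)
        + 18 * κ * (m⁻¹ * ∑ i ∈ H, ‖v i t - gradient (ℒ i) (x t)‖ ^ 2)
        + 3 * ‖vb - gradient LH (x t)‖ ^ 2 + 18 * κ * G ^ 2 := by
      have a1 := mul_nonneg hκ hA0
      have a2 := mul_nonneg hκ hB0
      have a3 := mul_nonneg hκ (sq_nonneg G)
      linarith
    have hde := aux_descent LH L hLHdiff hLHLip (x t) (-(γ • F w))
    have hstep : x (t + 1) = x t + -(γ • F w) := by rw [hx t, sub_eq_add_neg]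
    have hdiffx : x (t + 1) - x t = -(γ • F w) := by rw [hstep, add_sub_cancel_left]
    rw [hdiffx, hstep]
    have hns := norm_sub_sq_real (F w) (gradient LH (x t))
    rw [inner_neg_right, real_inner_smul_right, real_inner_comm] at hde
    have e5 : (1 / (2 * γ) - L / 2) * ‖-(γ • F w)‖ ^ 2
        = γ / 2 * ‖F w‖ ^ 2 - L / 2 * ‖-(γ • F w)‖ ^ 2 := by
      rw [norm_neg, norm_smul, Real.norm_eq_abs, mul_pow, sq_abs]
      field_simp
    rw [e5]
    have h9 := mul_le_mul_of_nonneg_left herr (by positivity : 0 ≤ γ / 2)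
    rw [hns] at h9
    linarith
  · exact fun t => ciInf_le hbdd (x t)
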